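/- Let G be a connected finite graph with n vertices, w: D(G) → ℂ a symmetric weight function with weighted matrix W, and set f_w(u,t) = det(I_n − t·W + (1−u)t^2(D_w − (1−u)I_n)). Then, as identities of rational functions in t: ∂f_w/∂t |_{(1−1/t,t)} = 2 t^{n−2}(w(G)t − n)·κ_w(G) and ∂f_w/∂u |_{(1−1/t,t)} = −2 t^{n}(w(G)t − n)·κ_w(G). -/

import Mathlib

open Finset SimpleGraph

/-- The weight of an unordered edge coming from a matrix of weights; for a symmetric matrix `M`
this is just the common value `M i j = M j i`. -/
noncomputable def edgeWeight {V : Type*} (M : Matrix V V ℂ) : Sym2 V → ℂ :=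
  Sym2.lift ⟨fun i j => (M i j + M j i) / 2, fun i j => by ring⟩

/-- The weight `w(T) = ∏_{e ∈ E(T)} w(e)` of a spanning tree `T`. -/
noncomputable def treeWeight {V : Type*} (M : Matrix V V ℂ) (T : SimpleGraph V) : ℂ :=
  ∏ᶠ e ∈ T.edgeSet, edgeWeight M e

/-- The weighted complexity `κ_w(G) = Σ_T w(T)`, the sum over all spanning trees of `G`. -/
noncomputable def weightedComplexity {V : Type*} (G : SimpleGraph V) (M : Matrix V V ℂ) : ℂ :=
  ∑ᶠ T ∈ {T : SimpleGraph V | T ≤ G ∧ T.IsTree}, treeWeight M T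

/-- The total weight `w(G) = Σ_{uv ∈ E(G)} w(u,v)`. -/
noncomputable def totalWeight {V : Type*} (G : SimpleGraph V) (M : Matrix V V ℂ) : ℂ :=
  ∑ᶠ e ∈ G.edgeSet, edgeWeight M e

/-- The weighted two-variable function f_w(u,t). -/
noncomputable def fW {n : ℕ} (W : Matrix (Fin n) (Fin n) ℂ) (u t : ℂ) : ℂ :=
  Matrix.det ((1 : Matrix (Fin n) (Fin n) ℂ) - t • W
    + ((1 - u) * t ^ 2) • (Matrix.diagonal (fun i => ∑ j, W i j) - (1 - u) • 1))


set_option linter.unusedSectionVars false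

section MatrixTree

variable {V : Type*} [Fintype V] [DecidableEq V]

/-- `f` is a parent function rooted at `r`. -/
def RootedFun (r : V) (f : V → V) : Prop :=
  f r = r ∧ ∀ C : Set V, (∀ i ∈ C, f i ∈ C) → ∀ i ∈ C, r ∈ C

/-- Graph of a parent function. -/
def parentGraph (r : V) (f : V → V) : SimpleGraph V :=
  SimpleGraph.fromEdgeSet ((fun i => s(i, f i)) '' {i | i ≠ r})

lemma RootedFun.ne {r : V} {f : V → V} (h : RootedFun r f) {i : V} (hi : i ≠ r) : f i ≠ i := by
  intro he
  have := h.2 {i} (by simp [he]) i (by simp)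
  simp only [Set.mem_singleton_iff] at this
  exact hi this.symm

lemma RootedFun.no2 {r : V} {f : V → V} (h : RootedFun r f) {i j : V} (hi : i ≠ r) (hj : j ≠ r)
    (h1 : f i = j) (h2 : f j = i) : False := by
  have := h.2 {i, j} (by simp [h1, h2]) i (by simp)
  simp only [Set.mem_insert_iff, Set.mem_singleton_iff] at this
  rcases this with h | h
  · exact hi h.symm
  · exact hj h.symm

lemma RootedFun.edge_injOn {r : V} {f : V → V} (h : RootedFun r f) :
    Set.InjOn (fun i => s(i, f i)) {i | i ≠ r} := by
  intro i hi j hj hij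
  simp only [Sym2.eq_iff] at hij
  rcases hij with h1 | h1
  · exact h1.1
  · exact (h.no2 hi hj h1.2 h1.1.symm).elim

lemma RootedFun.edgeSet {r : V} {f : V → V} (h : RootedFun r f) :
    (parentGraph r f).edgeSet = (fun i => s(i, f i)) '' {i | i ≠ r} := by
  unfold parentGraph
  rw [SimpleGraph.edgeSet_fromEdgeSet, sdiff_eq_left, Set.disjoint_left]
  rintro _ ⟨i, hi, rfl⟩ hd
  simp only [Sym2.mem_diagSet, Sym2.mk_isDiag_iff] at hd
  exact h.ne hi hd.symm

lemma RootedFun.card {r : V} {f : V → V} (h : RootedFun r f) :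
    Nat.card (parentGraph r f).edgeSet + 1 = Nat.card V := by
  rw [h.edgeSet, Nat.card_image_of_injOn h.edge_injOn]
  have : ({i | i ≠ r} : Set V) = ((Finset.univ.erase r : Finset V) : Set V) := by ext; simp
  rw [this, Nat.card_eq_card_toFinset]
  simp only [Finset.toFinset_coe, Finset.card_erase_of_mem (Finset.mem_univ r), Finset.card_univ,
    Nat.card_eq_fintype_card]
  have : 0 < Fintype.card V := Fintype.card_pos_iff.2 ⟨r⟩
  omega

lemma RootedFun.adj {r : V} {f : V → V} (h : RootedFun r f) {i : V} (hi : i ≠ r) :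
    (parentGraph r f).Adj i (f i) := by
  rw [← SimpleGraph.mem_edgeSet, h.edgeSet]
  exact ⟨i, hi, rfl⟩

lemma RootedFun.connected {r : V} {f : V → V} (h : RootedFun r f) :
    (parentGraph r f).Connected := by
  have key : ∀ i, (parentGraph r f).Reachable i r := by
    by_contra! hc
    obtain ⟨i, hi⟩ := hc
    refine h.2 {j | ¬ (parentGraph r f).Reachable j r} ?_ i hi (SimpleGraph.Reachable.refl r)
    intro j hj hj'
    by_cases hjr : j = r
    · subst hjr; exact hj (SimpleGraph.Reachable.refl _)
    · exact hj ((h.adj hjr).reachable.trans hj')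
  have : Nonempty V := ⟨r⟩
  exact SimpleGraph.Connected.mk (fun i j => (key i).trans (key j).symm)

lemma RootedFun.isTree {r : V} {f : V → V} (h : RootedFun r f) : (parentGraph r f).IsTree :=
  SimpleGraph.isTree_iff_connected_and_card.2 ⟨h.connected, h.card⟩

lemma RootedFun.inj {r : V} {f g : V → V} (hf : RootedFun r f) (hg : RootedFun r g)
    (he : parentGraph r f = parentGraph r g) : f = g := by
  by_contra hne
  obtain ⟨i, hi⟩ := Function.ne_iff.1 hne
  refine hg.2 {j | f j ≠ g j} ?_ i hi (hf.1.trans hg.1.symm)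
  intro j hj
  have hjr : j ≠ r := by rintro rfl; exact hj (hf.1.trans hg.1.symm)
  have h1 := hg.adj hjr
  rw [← he, ← SimpleGraph.mem_edgeSet, hf.edgeSet] at h1
  obtain ⟨k, hk, hk2⟩ := h1
  simp only [Sym2.eq_iff] at hk2
  rcases hk2 with ⟨rfl, h2⟩ | ⟨rfl, h2⟩
  · exact (hj h2).elim
  · intro h3
    exact hg.no2 hjr hk rfl (h3.symm.trans h2)

lemma exists_rootedFun (r : V) (T : SimpleGraph V) (hT : T.IsTree) :
    ∃ f, RootedFun r f ∧ parentGraph r f = T := by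
  have hstep : ∀ i, ∃ j, (i = r → j = r) ∧ (i ≠ r → T.Adj i j ∧ T.dist j r < T.dist i r) := by
    intro i
    by_cases hi : i = r
    · exact ⟨r, fun _ => rfl, fun h => (h hi).elim⟩
    · obtain ⟨p, hp⟩ := hT.connected.exists_walk_length_eq_dist i r
      cases p with
      | nil => exact (hi rfl).elim
      | cons hadj q =>
        refine ⟨_, fun h => (hi h).elim, fun _ => ⟨hadj, ?_⟩⟩
        rw [← hp, SimpleGraph.Walk.length_cons]
        exact Nat.lt_succ_of_le (SimpleGraph.dist_le q)
  choose f hf1 hf2 using hstep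
  have hR : RootedFun r f := by
    refine ⟨hf1 r rfl, fun C hC => ?_⟩
    have : ∀ n, ∀ i ∈ C, T.dist i r = n → r ∈ C := by
      intro n
      induction n using Nat.strong_induction_on with
      | _ n ih =>
        intro i hi hn
        by_cases hir : i = r
        · exact hir ▸ hi
        · exact ih _ (hn ▸ (hf2 i hir).2) (f i) (hC i hi) rfl
    exact fun i hi => this _ i hi rfl
  refine ⟨f, hR, ?_⟩
  have hsub : (parentGraph r f).edgeSet ⊆ T.edgeSet := by
    rw [hR.edgeSet]
    rintro _ ⟨i, hi, rfl⟩
    exact (hf2 i hi).1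
  have hc := (SimpleGraph.isTree_iff_connected_and_card.1 hT).2
  have hc2 := hR.card
  rw [← SimpleGraph.edgeSet_inj]
  apply Set.eq_of_subset_of_ncard_le hsub _ (Set.toFinite _)
  rw [← Nat.card_coe_set_eq, ← Nat.card_coe_set_eq]
  omega

lemma RootedFun.treeWeight_eq {r : V} {f : V → V} (h : RootedFun r f) (W : Matrix V V ℂ)
    (hWsym : ∀ i j, W i j = W j i) :
    treeWeight W (parentGraph r f) = ∏ i ∈ Finset.univ.erase r, W i (f i) := by
  unfold treeWeight
  rw [h.edgeSet, finprod_mem_image h.edge_injOn]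
  have : ({i | i ≠ r} : Set V) = ((Finset.univ.erase r : Finset V) : Set V) := by ext; simp
  rw [this, finprod_mem_coe_finset]
  refine Finset.prod_congr rfl fun i _ => ?_
  simp [edgeWeight, hWsym (f i) i]

lemma weightedComplexity_eq (G : SimpleGraph V) (W : Matrix V V ℂ)
    (hWsym : ∀ i j, W i j = W j i) (hW0 : ∀ i j, ¬ G.Adj i j → W i j = 0) (r : V) :
    weightedComplexity G W
      = ∑ᶠ f ∈ {f | RootedFun r f}, ∏ i ∈ Finset.univ.erase r, W i (f i) := by
  have h1 : weightedComplexity G W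
      = ∑ᶠ T ∈ {T : SimpleGraph V | T.IsTree}, treeWeight W T := by
    unfold weightedComplexity
    refine finsum_mem_inter_support_eq _ _ _ ?_
    ext T
    simp only [Set.mem_inter_iff, Set.mem_ofPred_eq, Function.mem_support]
    refine ⟨fun h => ⟨h.1.2, h.2⟩, fun h => ⟨⟨?_, h.1⟩, h.2⟩⟩
    obtain ⟨f, hf, rfl⟩ := exists_rootedFun r T h.1
    rw [← SimpleGraph.edgeSet_subset_edgeSet, hf.edgeSet]
    rintro _ ⟨i, hi, rfl⟩
    by_contra hn
    apply h.2
    rw [hf.treeWeight_eq W hWsym]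
    exact Finset.prod_eq_zero (Finset.mem_erase.2 ⟨hi, Finset.mem_univ i⟩) (hW0 _ _ hn)
  rw [h1]
  symm
  refine finsum_mem_eq_of_bijOn (parentGraph r) ⟨?_, ?_, ?_⟩ ?_
  · exact fun f hf => RootedFun.isTree hf
  · exact fun f hf g hg he => RootedFun.inj hf hg he
  · intro T hT
    obtain ⟨f, hf, h⟩ := exists_rootedFun r T hT
    exact ⟨f, hf, h⟩
  · exact fun f hf => (RootedFun.treeWeight_eq hf W hWsym).symm

/-- Matrix with rows `e_i - e_{f i}`, and `e_r` at `r`. -/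
def funMatrix (r : V) (f : V → V) : Matrix V V ℂ :=
  fun i => if i = r then Pi.single r 1 else Pi.single i 1 - Pi.single (f i) 1

lemma det_funMatrix_of_rooted {r : V} {f : V → V} (h : RootedFun r f) :
    (funMatrix r f).det = 1 := by
  have hk : ∀ i, ∃ k, f^[k] i = r := fun i => by
    have := h.2 {j | ∃ k, f^[k] i = j} (by
      rintro _ ⟨k, rfl⟩; exact ⟨k + 1, Function.iterate_succ_apply' f k i⟩) i ⟨0, rfl⟩
    exact this
  let d : V → ℕ := fun i => Nat.find (hk i)
  have hd : ∀ i, i ≠ r → d (f i) < d i := by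
    intro i hi
    have h1 : f^[d i] i = r := Nat.find_spec (hk i)
    have h0 : d i ≠ 0 := by
      intro h0; rw [h0] at h1; exact hi h1
    obtain ⟨m, hm⟩ := Nat.exists_eq_succ_of_ne_zero h0
    rw [hm] at h1 ⊢
    exact Nat.lt_succ_of_le (Nat.find_min' (hk (f i)) h1)
  have hent : ∀ i j, d i ≤ d j → funMatrix r f i j = if i = j then 1 else 0 := by
    intro i j hij
    unfold funMatrix
    by_cases hi : i = r
    · subst hi; simp [Pi.single_apply, eq_comm]
    · have : j ≠ f i := by rintro rfl; exact absurd (hd i hi) (by omega)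
      simp [hi, Pi.single_apply, this, eq_comm]
  have hbt : (funMatrix r f).BlockTriangular (fun i => OrderDual.toDual (d i)) := by
    intro i j hij
    have hlt : d i < d j := OrderDual.toDual_lt_toDual.1 hij
    rw [hent i j hlt.le, if_neg (by rintro rfl; exact lt_irrefl _ hlt)]
  rw [hbt.det]
  refine Finset.prod_eq_one fun a _ => ?_
  have : (funMatrix r f).toSquareBlock (fun i => OrderDual.toDual (d i)) a = 1 := by
    ext ⟨i, hi⟩ ⟨j, hj⟩
    have : d i = d j := OrderDual.toDual.injective (hi.trans hj.symm)
    simp only [Matrix.toSquareBlock_def, Matrix.of_apply]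
    rw [hent i j this.le, Matrix.one_apply]
    simp
  rw [this, Matrix.det_one]

lemma det_funMatrix_of_not_rooted {r : V} {f : V → V} (hr : f r = r) (h : ¬ RootedFun r f) :
    (funMatrix r f).det = 0 := by
  classical
  simp only [RootedFun, not_and, not_forall] at h
  obtain ⟨C, hC, i, hi, hrC⟩ := h hr
  let S : Set V := {j | ∃ k, f^[k] j ∈ C}
  have hCi : ∀ k, ∀ j ∈ C, f^[k] j ∈ C := by
    intro k
    induction k with
    | zero => exact fun j hj => hj
    | succ k ih => exact fun j hj => ih _ (hC j hj)
  have hS : ∀ j, f j ∈ S ↔ j ∈ S := by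
    intro j
    constructor
    · rintro ⟨k, hk⟩; exact ⟨k + 1, hk⟩
    · rintro ⟨k, hk⟩
      exact ⟨k, by
        rw [← Function.iterate_succ_apply, Function.iterate_succ_apply']; exact hC _ hk⟩
  have hrS : r ∉ S := by
    rintro ⟨k, hk⟩
    rw [Function.iterate_fixed hr] at hk
    exact hrC hk
  rw [← Matrix.exists_mulVec_eq_zero_iff]
  refine ⟨fun j => if j ∈ S then 1 else 0, ?_, ?_⟩
  · intro h0
    have := congrFun h0 i
    have hiS : i ∈ S := ⟨0, hi⟩
    simp [hiS] at this
  · ext j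
    simp only [Matrix.mulVec, funMatrix, Pi.zero_apply]
    by_cases hj : j = r
    · simp [hj, hrS]
    · rw [if_neg hj, sub_dotProduct]
      simp [hS j]

lemma adjugate_diag (G : SimpleGraph V) (W : Matrix V V ℂ)
    (hWsym : ∀ i j, W i j = W j i) (hW0 : ∀ i j, ¬ G.Adj i j → W i j = 0) (r : V) :
    (Matrix.diagonal (fun i => ∑ j, W i j) - W).adjugate r r = weightedComplexity G W := by
  classical
  rw [Matrix.adjugate_apply, weightedComplexity_eq G W hWsym hW0 r]
  let c : V → V → ℂ := fun i j => if i = r then (if j = r then 1 else 0) else W i j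
  let v : V → V → V → ℂ := fun i j =>
    if i = r then Pi.single r 1 else Pi.single i 1 - Pi.single j 1
  have hM : (Matrix.diagonal (fun i => ∑ j, W i j) - W).updateRow r (Pi.single r 1)
      = fun i => ∑ j, c i j • v i j := by
    ext i k
    rw [Finset.sum_apply]
    by_cases hi : i = r
    · subst hi; simp [c, v]
    · rw [Matrix.updateRow_ne hi]
      simp only [c, v, if_neg hi, Pi.smul_apply, Pi.sub_apply, smul_eq_mul, mul_sub,
        Finset.sum_sub_distrib, Pi.single_apply, Matrix.sub_apply, Matrix.diagonal_apply]
      by_cases hik : i = k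
      · subst hik; simp
      · simp [hik, Ne.symm hik]
  have hdet : ((Matrix.diagonal (fun i => ∑ j, W i j) - W).updateRow r (Pi.single r 1)).det
      = ∑ f : V → V, (∏ i, c i (f i)) * (funMatrix r f).det := by
    rw [hM]
    have h1 := (Matrix.detRowAlternating (n := V) (R := ℂ)).toMultilinearMap.map_sum
      (fun i j => c i j • v i j)
    refine h1.trans (Finset.sum_congr rfl fun f _ => ?_)
    rw [MultilinearMap.map_smul_univ]
    rfl
  rw [hdet, finsum_mem_def, finsum_eq_sum_of_fintype]
  refine Finset.sum_congr rfl fun f _ => ?_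
  by_cases hr : f r = r
  · by_cases hf : RootedFun r f
    · rw [det_funMatrix_of_rooted hf, Set.indicator_of_mem (show f ∈ {f | RootedFun r f} from hf),
        mul_one, ← Finset.prod_erase_mul _ _ (Finset.mem_univ r)]
      simp only [c, hr, if_true, mul_one]
      exact Finset.prod_congr rfl fun i hi => if_neg (Finset.ne_of_mem_erase hi)
    · rw [det_funMatrix_of_not_rooted hr hf,
        Set.indicator_of_notMem (show f ∉ {f | RootedFun r f} from hf), mul_zero]
  · rw [Set.indicator_of_notMem (show f ∉ {f | RootedFun r f} from fun hf => hr hf.1),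
      Finset.prod_eq_zero (Finset.mem_univ r) (by simp [c, hr]), zero_mul]

lemma adjugate_lap (G : SimpleGraph V) (W : Matrix V V ℂ)
    (hWsym : ∀ i j, W i j = W j i) (hW0 : ∀ i j, ¬ G.Adj i j → W i j = 0) (r s : V) :
    (Matrix.diagonal (fun i => ∑ j, W i j) - W).adjugate r s = weightedComplexity G W := by
  rw [← adjugate_diag G W hWsym hW0 s, Matrix.adjugate_apply, Matrix.adjugate_apply, ← sub_eq_zero,
    sub_eq_add_neg, ← neg_one_mul, ← Matrix.det_updateRow_smul, ← Matrix.det_updateRow_add]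
  rw [← Matrix.exists_mulVec_eq_zero_iff]
  refine ⟨fun _ => 1, fun h => one_ne_zero (congrFun h r), ?_⟩
  ext i
  by_cases hi : i = s
  · subst hi; simp [Matrix.mulVec, dotProduct, Finset.sum_add_distrib]
  · simp [Matrix.mulVec, dotProduct, Matrix.updateRow_ne hi, Finset.sum_sub_distrib, Matrix.diagonal_apply]

lemma hasDerivAt_det (M : ℂ → Matrix V V ℂ) (M' : Matrix V V ℂ) (t : ℂ)
    (h : ∀ i j, HasDerivAt (fun s => M s i j) (M' i j) t) :
    HasDerivAt (fun s => (M s).det) (((M t).adjugate * M').trace) t := by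
  have h1 : HasDerivAt (fun s => (M s).det)
      (∑ σ : Equiv.Perm V, ((Equiv.Perm.sign σ : ℤ) : ℂ) *
        ∑ i, (∏ j ∈ Finset.univ.erase i, M t (σ j) j) * M' (σ i) i) t := by
    simp only [Matrix.det_apply']
    refine HasDerivAt.fun_sum fun σ _ => HasDerivAt.const_mul _ ?_
    have := HasDerivAt.fun_finsetProd (u := Finset.univ) (fun i _ => h (σ i) i)
    simpa using this
  convert h1 using 1
  simp only [Matrix.trace, Matrix.diag]
  have h2 : ∀ i, ((M t).adjugate * M') i i = ((M t).updateCol i (fun j => M' j i)).det := by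
    intro i
    rw [← Matrix.cramer_apply, Matrix.cramer_eq_adjugate_mulVec]
    rfl
  simp only [h2, Matrix.det_apply', Finset.mul_sum]
  rw [Finset.sum_comm]
  refine Finset.sum_congr rfl fun σ _ => Finset.sum_congr rfl fun i _ => ?_
  rw [← Finset.prod_erase_mul _ _ (Finset.mem_univ i)]
  simp only [Matrix.updateCol_self]
  congr 2
  refine Finset.prod_congr rfl fun j hj => ?_
  rw [Matrix.updateCol_ne (Finset.ne_of_mem_erase hj)]

lemma trace_const_mul (k : ℂ) (A B : Matrix V V ℂ) (h : ∀ i j, A i j = k) :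
    (A * B).trace = k * ∑ i, ∑ j, B i j := by
  simp only [Matrix.trace, Matrix.diag, Matrix.mul_apply, h, Finset.mul_sum]
  exact Finset.sum_comm

end MatrixTree

lemma totalWeight_two {n : ℕ} (G : SimpleGraph (Fin n)) (W : Matrix (Fin n) (Fin n) ℂ)
    (hWsym : ∀ i j, W i j = W j i)
    (hW0 : ∀ i j, ¬ G.Adj i j → W i j = 0) :
    ∑ i, ∑ j, W i j = 2 * totalWeight G W := by
  classical
  have h1 : totalWeight G W = ∑ e ∈ (Finset.univ : Finset (Fin n)).sym2 with ¬ e.IsDiag, edgeWeight W e := by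
    unfold totalWeight
    rw [← finsum_mem_coe_finset]
    refine finsum_mem_inter_support_eq _ _ _ ?_
    ext e
    induction e with
    | _ i j =>
    simp only [Set.mem_inter_iff, SimpleGraph.mem_edgeSet, Function.mem_support, Finset.coe_filter,
      Set.mem_ofPred_eq, Sym2.mk_isDiag_iff]
    refine ⟨fun h => ⟨⟨by simp, h.1.ne⟩, h.2⟩, fun h => ⟨?_, h.2⟩⟩
    by_contra hn
    exact h.2 (by simp [edgeWeight, hWsym j i, hW0 i j hn])
  have h2 : totalWeight G W = ∑ i, ∑ j, if i < j then W i j else 0 := by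
    rw [h1, Finset.sum_sym2_filter_not_isDiag, ← Finset.sum_product', ← Finset.sum_filter]
    refine Finset.sum_congr ?_ fun p _ => ?_
    · ext p
      simp only [Finset.mem_filter, Finset.mem_offDiag, Finset.mem_univ, true_and,
        Finset.mem_product]
      exact ⟨fun h => h.2, fun h => ⟨h.ne, h⟩⟩
    · simp [edgeWeight, hWsym p.2 p.1]
  have h3 : totalWeight G W = ∑ i, ∑ j, if j < i then W i j else 0 := by
    rw [h2, Finset.sum_comm]
    simp only [hWsym]
  have h4 : 2 * totalWeight G W = totalWeight G W + totalWeight G W := by ring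
  rw [h4]
  nth_rewrite 1 [h2]
  rw [h3, ← Finset.sum_add_distrib]
  refine Finset.sum_congr rfl fun i _ => ?_
  rw [← Finset.sum_add_distrib]
  refine Finset.sum_congr rfl fun j _ => ?_
  rcases lt_trichotomy i j with h | h | h
  · simp [h, h.le]
  · subst h; simp [hW0 i i (SimpleGraph.irrefl G)]
  · simp [h, h.le]

theorem stmt11 {n : ℕ} (G : SimpleGraph (Fin n)) [DecidableRel G.Adj]
    (hG : G.Connected) (W : Matrix (Fin n) (Fin n) ℂ)
    (hWsym : ∀ i j, W i j = W j i)
    (hW0 : ∀ i j, ¬ G.Adj i j → W i j = 0) :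
    ∀ t : ℂ, t ≠ 0 →
      deriv (fun s => fW W (1 - 1/t) s) t
          = 2 * t ^ ((n : ℤ) - 2) * (totalWeight G W * t - n) * weightedComplexity G W
      ∧ deriv (fun v => fW W v t) (1 - 1/t)
          = -(2 * t ^ (n : ℤ) * (totalWeight G W * t - n) * weightedComplexity G W) := by
  intro t ht
  obtain ⟨m, rfl⟩ : ∃ m, n = m + 1 := by
    obtain ⟨i⟩ := hG.nonempty
    exact Nat.exists_eq_succ_of_ne_zero (by have := i.2; omega)
  have hw := totalWeight_two G W hWsym hW0
  have hD : ∑ i, ∑ j, Matrix.diagonal (fun i => ∑ j, W i j) i j = 2 * totalWeight G W := by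
    rw [← hw]; simp [Matrix.diagonal_apply]
  have h1 : ∑ i : Fin (m+1), ∑ j, (1 : Matrix (Fin (m+1)) (Fin (m+1)) ℂ) i j = (m : ℂ) + 1 := by
    simp [Matrix.one_apply]
  have hadj : ∀ A : Matrix (Fin (m+1)) (Fin (m+1)) ℂ,
      A = t • (Matrix.diagonal (fun i => ∑ j, W i j) - W) →
      ∀ i j, A.adjugate i j = t ^ m * weightedComplexity G W := by
    rintro _ rfl i j
    rw [Matrix.adjugate_smul, Matrix.smul_apply, adjugate_lap G W hWsym hW0]
    simp
  have hz1 : t ^ (((m + 1 : ℕ) : ℤ) - 2) = t ^ m / t := by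
    rw [show (((m + 1 : ℕ) : ℤ) - 2) = (m : ℤ) - 1 by push_cast; ring, zpow_sub_one₀ ht]
    rfl
  constructor
  · have hd := hasDerivAt_det (fun s => (1 : Matrix (Fin (m+1)) (Fin (m+1)) ℂ) - s • W
      + ((1 - (1 - 1/t)) * s ^ 2) • (Matrix.diagonal (fun i => ∑ j, W i j) - (1 - (1 - 1/t)) • 1))
      (- W + (2 : ℂ) • Matrix.diagonal (fun i => ∑ j, W i j) - (2 / t) • 1) t (by
        intro i j
        simp only [Matrix.add_apply, Matrix.sub_apply, Matrix.smul_apply, smul_eq_mul,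
          Matrix.neg_apply]
        have ha := ((hasDerivAt_id t).mul_const (W i j)).const_sub ((1 : Matrix (Fin (m+1)) (Fin (m+1)) ℂ) i j)
        have hb := ((hasDerivAt_pow 2 t).const_mul (1 - (1 - 1/t))).mul_const
          (Matrix.diagonal (fun i => ∑ j, W i j) i j - (1 - (1 - 1/t)) * (1 : Matrix (Fin (m+1)) (Fin (m+1)) ℂ) i j)
        refine HasDerivAt.congr_deriv (ha.add hb) ?_
        simp only [Nat.cast_ofNat]
        field_simp
        ring)
    refine hd.deriv.trans ?_
    rw [trace_const_mul _ _ _ (hadj _ ?_)]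
    · simp only [Matrix.add_apply, Matrix.sub_apply, Matrix.smul_apply, smul_eq_mul,
          Matrix.neg_apply, Finset.sum_add_distrib, Finset.sum_sub_distrib, ← Finset.mul_sum, Finset.sum_neg_distrib, hw, hD, h1, hz1]
      push_cast
      field_simp
      ring
    · ext i j
      simp only [Matrix.add_apply, Matrix.sub_apply, Matrix.smul_apply, smul_eq_mul]
      field_simp
      ring
  · have hd := hasDerivAt_det (fun u => (1 : Matrix (Fin (m+1)) (Fin (m+1)) ℂ) - t • W
      + ((1 - u) * t ^ 2) • (Matrix.diagonal (fun i => ∑ j, W i j) - (1 - u) • 1))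
      ((2 * t) • 1 - (t ^ 2) • Matrix.diagonal (fun i => ∑ j, W i j)) (1 - 1 / t) (by
        intro i j
        simp only [Matrix.add_apply, Matrix.sub_apply, Matrix.smul_apply, smul_eq_mul]
        have h0 := (hasDerivAt_id (1 - 1/t)).const_sub 1
        have ha := h0.mul_const (t ^ 2)
        have hb := (h0.mul_const ((1 : Matrix (Fin (m+1)) (Fin (m+1)) ℂ) i j)).const_sub
          (Matrix.diagonal (fun i => ∑ j, W i j) i j)
        refine HasDerivAt.congr_deriv ((ha.mul hb).const_add
          ((1 : Matrix (Fin (m+1)) (Fin (m+1)) ℂ) i j - t * W i j)) ?_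
        simp only [id]
        field_simp
        ring)
    refine hd.deriv.trans ?_
    rw [trace_const_mul _ _ _ (hadj _ ?_)]
    · simp only [Matrix.add_apply, Matrix.sub_apply, Matrix.smul_apply, smul_eq_mul,
          Finset.sum_sub_distrib, ← Finset.mul_sum, hD, h1, zpow_natCast]
      push_cast
      ring
    · ext i j
      simp only [Matrix.add_apply, Matrix.sub_apply, Matrix.smul_apply, smul_eq_mul]
      field_simp
      ring
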